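/- For y ∈ ℝ let s(y) = y − ⌊y + 1/2⌋ (the periodized sawtooth, taking values in [−1/2, 1/2)), and let G(t) = lim_{R→∞} ∫_{−R}^{R} s(t + η²/2) dη (which exists for every t). Then G is Hölder continuous with exponent 1/2: there exists a constant C such that |G(t) − G(t′)| ≤ C|t − t′|^{1/2} for all t, t′ ∈ ℝ. -/

import Mathlib

open Filter

/-- The periodized sawtooth `s(y) = y − ⌊y + 1/2⌋`, taking values in `[−1/2, 1/2)`. -/
noncomputable def saw (y : ℝ) : ℝ := y - ⌊y + 1 / 2⌋

open MeasureTheory Set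

lemma abs_saw_le (y : ℝ) : |saw y| ≤ 1 / 2 := by
  have h₁ := Int.floor_le (y + 1 / 2)
  have h₂ := Int.lt_floor_add_one (y + 1 / 2)
  rw [saw, abs_le]
  constructor <;> linarith

lemma measurable_saw : Measurable saw := by
  unfold saw
  fun_prop

lemma continuousWithinAt_saw_Ici (y : ℝ) : ContinuousWithinAt saw (Ici y) y := by
  have hmap : Tendsto (fun z : ℝ => z + 1 / 2) (nhdsWithin y (Ici y))
      (nhdsWithin (y + 1 / 2) (Ici (y + 1 / 2))) := by
    refine tendsto_nhdsWithin_of_tendsto_nhds_of_eventually_within _ ?_ ?_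
    · exact ((continuous_id.add continuous_const).tendsto y).mono_left nhdsWithin_le_nhds
    · filter_upwards [self_mem_nhdsWithin] with z hz
      exact add_le_add_left (mem_Ici.1 hz) _
  have hfloor := tendsto_pure.1 ((tendsto_floor_right_pure_floor (y + 1 / 2)).comp hmap)
  have hlin : ContinuousWithinAt (fun z : ℝ => z - (⌊y + 1 / 2⌋ : ℝ)) (Ici y) y := by fun_prop
  refine hlin.congr_of_eventuallyEq ?_ rfl
  filter_upwards [hfloor] with z hz
  simp only [Function.comp_apply] at hz
  rw [saw, hz]

lemma intervalIntegrable_saw_comp {g : ℝ → ℝ} (hg : Measurable g) (a b : ℝ) :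
    IntervalIntegrable (fun x => saw (g x)) volume a b := by
  refine (intervalIntegrable_const (c := (1 / 2 : ℝ))).mono_fun
    (measurable_saw.comp hg).aestronglyMeasurable (Eventually.of_forall fun x => ?_)
  simpa [Real.norm_eq_abs] using abs_saw_le (g x)

lemma intervalIntegrable_saw (a b : ℝ) : IntervalIntegrable saw volume a b :=
  intervalIntegrable_saw_comp measurable_id a b

/-- A primitive of the sawtooth. -/
noncomputable def sawPrimitive (y : ℝ) : ℝ := ∫ x in (0 : ℝ)..y, saw x

lemma abs_sawPrimitive_sub_le (y z : ℝ) :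
    |sawPrimitive y - sawPrimitive z| ≤ 1 / 2 * |y - z| := by
  rw [sawPrimitive, sawPrimitive, intervalIntegral.integral_interval_sub_left
    (intervalIntegrable_saw _ _) (intervalIntegrable_saw _ _), ← Real.norm_eq_abs,
    ← Real.norm_eq_abs]
  exact intervalIntegral.norm_integral_le_of_norm_le_const fun x _ => abs_saw_le x

lemma continuous_sawPrimitive : Continuous sawPrimitive :=
  intervalIntegral.continuous_primitive intervalIntegrable_saw 0

lemma hasDerivWithinAt_sawPrimitive (y : ℝ) :
    HasDerivWithinAt sawPrimitive (saw y) (Ioi y) y :=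
  (intervalIntegral.integral_hasDerivWithinAt_right (intervalIntegrable_saw 0 y)
    (s := Ici y) (t := Ioi y)
    measurable_saw.stronglyMeasurable.stronglyMeasurableAtFilter
    ((continuousWithinAt_saw_Ici y).mono Ioi_subset_Ici_self)).mono Ioi_subset_Ici_self

lemma hasDerivWithinAt_sawPrimitive_comp (t : ℝ) {x : ℝ} (hx : 0 < x) :
    HasDerivWithinAt (fun η : ℝ => sawPrimitive (t + η ^ 2 / 2))
      (saw (t + x ^ 2 / 2) * x) (Ioi x) x := by
  have hq : HasDerivAt (fun η : ℝ => t + η ^ 2 / 2) x x := by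
    have h := (((hasDerivAt_id x).pow 2).div_const 2).const_add t
    refine h.congr_deriv ?_
    simp
  refine (hasDerivWithinAt_sawPrimitive (t + x ^ 2 / 2)).comp x hq.hasDerivWithinAt ?_
  intro η hη
  have hη' : x < η := hη
  simp only [mem_Ioi]
  nlinarith

lemma integral_inv_sq {a b : ℝ} (ha : 0 < a) (hab : a ≤ b) :
    IntervalIntegrable (fun x : ℝ => 1 / x ^ 2) volume a b ∧
      ∫ x in a..b, 1 / x ^ 2 = 1 / a - 1 / b := by
  have hpos : ∀ x ∈ uIcc a b, 0 < x := fun x hx => by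
    rw [uIcc_of_le hab] at hx
    exact ha.trans_le hx.1
  have hint : IntervalIntegrable (fun x : ℝ => 1 / x ^ 2) volume a b :=
    (continuousOn_const.div (by fun_prop)
      fun x hx => (pow_pos (hpos x hx) 2).ne').intervalIntegrable
  refine ⟨hint, ?_⟩
  rw [intervalIntegral.integral_eq_sub_of_hasDerivAt (f := fun x => -x⁻¹) (fun x hx => ?_) hint]
  · simp only [one_div]
    ring
  · refine (hasDerivAt_inv (hpos x hx).ne').neg.congr_deriv ?_
    simp [one_div]

/-- Integration by parts: away from the stationary point of the phase, the oscillatory integral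
is Lipschitz in the shift. -/
lemma abs_integral_saw_sub_le (t t' : ℝ) {a b : ℝ} (ha : 0 < a) (hab : a ≤ b) :
    |∫ η in a..b, (saw (t + η ^ 2 / 2) - saw (t' + η ^ 2 / 2))| ≤ |t - t'| / a := by
  set D : ℝ → ℝ := fun η => sawPrimitive (t + η ^ 2 / 2) - sawPrimitive (t' + η ^ 2 / 2) with hD
  have hDle : ∀ η, |D η| ≤ 1 / 2 * |t - t'| := fun η => by
    have h := abs_sawPrimitive_sub_le (t + η ^ 2 / 2) (t' + η ^ 2 / 2)
    rwa [add_sub_add_right_eq_sub] at h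
  have hDcont : Continuous D := by
    have := continuous_sawPrimitive
    fun_prop
  have hpos : ∀ x ∈ Icc a b, 0 < x := fun x hx => ha.trans_le hx.1
  have hsaw : IntervalIntegrable (fun η => saw (t + η ^ 2 / 2) - saw (t' + η ^ 2 / 2))
      volume a b :=
    (intervalIntegrable_saw_comp (by fun_prop) a b).sub
      (intervalIntegrable_saw_comp (by fun_prop) a b)
  have hrem : IntervalIntegrable (fun η => D η / η ^ 2) volume a b := by
    refine (hDcont.continuousOn.div (by fun_prop) fun x hx => ?_).intervalIntegrable
    rw [uIcc_of_le hab] at hx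
    exact (pow_pos (hpos x hx) 2).ne'
  have hparts := intervalIntegral.integral_eq_sub_of_hasDeriv_right_of_le hab
    (f := fun η => D η / η)
    (f' := fun η => (saw (t + η ^ 2 / 2) - saw (t' + η ^ 2 / 2)) - D η / η ^ 2)
    (hDcont.continuousOn.div continuousOn_id fun x hx => (hpos x hx).ne')
    (fun x hx => by
      have hx0 := hpos x (Ioo_subset_Icc_self hx)
      have h := ((hasDerivWithinAt_sawPrimitive_comp t hx0).sub
        (hasDerivWithinAt_sawPrimitive_comp t' hx0)).div
        (hasDerivWithinAt_id x (Ioi x)) hx0.ne'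
      refine h.congr_deriv ?_
      simp only [hD, id, Pi.sub_apply]
      field_simp)
    (hsaw.sub hrem)
  rw [intervalIntegral.integral_sub hsaw hrem] at hparts
  obtain ⟨hint, hval⟩ := integral_inv_sq ha hab
  have hremle : |∫ η in a..b, D η / η ^ 2| ≤ 1 / 2 * |t - t'| * (1 / a - 1 / b) := by
    rw [← hval, ← intervalIntegral.integral_const_mul, ← Real.norm_eq_abs]
    refine intervalIntegral.norm_integral_le_of_norm_le hab
      (Eventually.of_forall fun x _ => ?_) (hint.const_mul _)
    rw [Real.norm_eq_abs, abs_div, abs_of_nonneg (sq_nonneg x), mul_one_div]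
    exact div_le_div_of_nonneg_right (hDle x) (sq_nonneg x)
  have hend : ∀ c, 0 < c → |D c / c| ≤ 1 / 2 * |t - t'| * (1 / c) := fun c hc => by
    rw [abs_div, abs_of_pos hc, mul_one_div]
    exact div_le_div_of_nonneg_right (hDle c) hc.le
  have h₁ := abs_le.1 (hend a ha)
  have h₂ := abs_le.1 (hend b (ha.trans_le hab))
  have h₃ := abs_le.1 hremle
  have h₄ : |t - t'| / a = |t - t'| * (1 / a) := by ring
  rw [h₄, abs_le]
  constructor <;> linarith

lemma abs_integral_saw_sub_le_sqrt {t t' R : ℝ} (h : t ≠ t') (hR : √|t - t'| ≤ R) :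
    |∫ η in (0 : ℝ)..R, (saw (t + η ^ 2 / 2) - saw (t' + η ^ 2 / 2))| ≤ 2 * √|t - t'| := by
  have hpos : 0 < √|t - t'| := Real.sqrt_pos.2 (abs_pos.2 (sub_ne_zero.2 h))
  have hint : ∀ a b, IntervalIntegrable
      (fun η => saw (t + η ^ 2 / 2) - saw (t' + η ^ 2 / 2)) volume a b := fun a b =>
    (intervalIntegrable_saw_comp (by fun_prop) a b).sub
      (intervalIntegrable_saw_comp (by fun_prop) a b)
  rw [← intervalIntegral.integral_add_adjacent_intervals (hint 0 √|t - t'|) (hint _ R)]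
  have hnear : |∫ η in (0 : ℝ)..√|t - t'|, (saw (t + η ^ 2 / 2) - saw (t' + η ^ 2 / 2))|
      ≤ 1 * |√|t - t'| - 0| := by
    rw [← Real.norm_eq_abs]
    refine intervalIntegral.norm_integral_le_of_norm_le_const fun η _ => ?_
    rw [Real.norm_eq_abs]
    have := abs_sub (saw (t + η ^ 2 / 2)) (saw (t' + η ^ 2 / 2))
    linarith [abs_saw_le (t + η ^ 2 / 2), abs_saw_le (t' + η ^ 2 / 2)]
  rw [sub_zero, abs_of_pos hpos, one_mul] at hnear
  have hfar := abs_integral_saw_sub_le t t' hpos hR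
  rw [Real.div_sqrt] at hfar
  refine (abs_add_le _ _).trans ?_
  linarith

lemma integral_saw_symm (t R : ℝ) :
    ∫ η in (-R)..R, saw (t + η ^ 2 / 2) = 2 * ∫ η in (0 : ℝ)..R, saw (t + η ^ 2 / 2) := by
  have hneg : ∫ η in (-R)..0, saw (t + η ^ 2 / 2) = ∫ η in (0 : ℝ)..R, saw (t + η ^ 2 / 2) := by
    have h := intervalIntegral.integral_comp_neg (a := 0) (b := R)
      (fun η => saw (t + η ^ 2 / 2))
    simpa using h.symm
  rw [← intervalIntegral.integral_add_adjacent_intervals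
    (intervalIntegrable_saw_comp (by fun_prop) (-R) 0)
    (intervalIntegrable_saw_comp (by fun_prop) 0 R), hneg, two_mul]

/-- the function `G(t) = lim_{R→∞} ∫_{−R}^{R} s(t + η²/2) dη`
is Hölder continuous with exponent `1/2`:
`|G(t) − G(t′)| ≤ C |t − t′|^{1/2}` for some constant `C`. -/
theorem stmt_19 (G : ℝ → ℝ)
    (hG : ∀ t : ℝ,
      Tendsto (fun R : ℝ => ∫ η in (-R)..R, saw (t + η ^ 2 / 2)) atTop (nhds (G t))) :
    ∃ C : ℝ, ∀ t t' : ℝ, |G t - G t'| ≤ C * Real.sqrt |t - t'| := by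
  refine ⟨4, fun t t' => ?_⟩
  rcases eq_or_ne t t' with rfl | h
  · simp
  refine le_of_tendsto ((hG t).sub (hG t')).abs ?_
  filter_upwards [eventually_ge_atTop √|t - t'|] with R hR
  have hle := abs_integral_saw_sub_le_sqrt h hR
  rw [intervalIntegral.integral_sub (intervalIntegrable_saw_comp (by fun_prop) 0 R)
    (intervalIntegrable_saw_comp (by fun_prop) 0 R)] at hle
  rw [integral_saw_symm, integral_saw_symm, ← mul_sub, abs_mul, abs_two]
  linarith
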